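/- Fix real numbers α, ε with 0 < α < ε < 1/10 and set β := −1 + ε. Let v := 1 − 3L + (1/2)P, w := H − 6L + (1/6)P, e := 2 − H + L + (1/3)P (the Chern character of 𝓔), and q := 3 − 2H + 4L + (2/3)P (the Chern character of 𝒬(−H)), and set p₁ := Z_{α,β}(e) and p₂ := −Z_{α,β}(q) (the central charge of 𝒬(−H)[1]). Then no integral linear combination of Z_{α,β}(v) and Z_{α,β}(w) lies in the open parallelogram spanned by p₁ and p₂: for all integers n, m and all real s, t with 0 < s < 1 and 0 < t < 1, one has n·Z_{α,β}(v) + m·Z_{α,β}(w) ≠ s·p₁ + t·p₂. (Explicitly, Z_{α,β}(v) = (5α² − 2 + 10ε − 5ε²) + 10(1−ε)i, Z_{α,β}(w) = (−4 + 10ε) + 10i, p₁ = (10α² − 1 + 10ε − 10ε²) + 10(1−2ε)i, and p₂ = (−15α² − 1 − 10ε + 15ε²) − 10(1−3ε)i; moreover p₁ + p₂ = Z_{α,β}(w) − Z_{α,β}(v), so (n,m) = (−1,1) gives exactly the closed corner s = t = 1.) This is the numerical verification that the projection object π(𝓔) is σ(α, −1+ε)-stable in the Kuznetsov component 𝒦u(X).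 -/

import Mathlib

namespace GMpaper

/-- An element `(r, c, s, t)` of `ℚ × ℚ × ℚ × ℚ` stands for `r·1 + c·H + s·L + t·P`
in the numerical intersection ring of a GM threefold. -/
abbrev R4 : Type := ℚ × ℚ × ℚ × ℚ

/-- The tilt central charge: for `u = r·1 + c·H + s·L + t·P`,
`Z_{α,β}(u) = (5α²r - s + 10βc - 5β²r) + 10(c - βr)·i`. -/
noncomputable def Z (α β : ℝ) (u : R4) : ℂ :=
  ((5 * α ^ 2 * (u.1 : ℝ) - (u.2.2.1 : ℝ) + 10 * β * (u.2.1 : ℝ)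
      - 5 * β ^ 2 * (u.1 : ℝ) : ℝ) : ℂ)
    + ((10 * ((u.2.1 : ℝ) - β * (u.1 : ℝ)) : ℝ) : ℂ) * Complex.I

/-- `v = 1 - 3L + (1/2)P`. -/
def v : R4 := (1, 0, -3, 1/2)
/-- `w = H - 6L + (1/6)P`. -/
def w : R4 := (0, 1, -6, 1/6)
/-- `e = 2 - H + L + (1/3)P`, the Chern character of `𝓔`. -/
def e : R4 := (2, -1, 1, 1/3)
/-- `q = 3 - 2H + 4L + (2/3)P`, the Chern character of `𝒬(-H)`. -/
def q : R4 := (3, -2, 4, 2/3)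

theorem aux (d ε : ℝ) (hε0 : 0 < ε) (hε : ε < 1/10) (hd0 : 0 < d) (hd : d < 1/100)
    (n m : ℤ) (s t : ℝ) (hs0 : 0 < s) (hs1 : s < 1) (ht0 : 0 < t) (ht1 : t < 1)
    (him : (n:ℝ) * (1 - ε) + m = s * (1 - 2 * ε) - t * (1 - 3 * ε))
    (hre : (n:ℝ) * (-2 + 10 * ε - 5 * d) + m * (-4 + 10 * ε)
      = s * (-1 + 10 * ε - 10 * d) + t * (-1 - 10 * ε + 15 * d)) : False := by
  obtain ⟨k, rfl⟩ : ∃ k : ℤ, m = k - n := ⟨m + n, by ring⟩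
  push_cast at him hre
  have hk : (k:ℝ) = n * ε + s * (1 - 2 * ε) - t * (1 - 3 * ε) := by linarith
  have hn : (n:ℝ) * (2 - 5 * d - 4 * ε + 10 * ε ^ 2)
      = s * (3 - 8 * ε + 20 * ε ^ 2 - 10 * d) - t * (5 - 12 * ε + 30 * ε ^ 2 - 15 * d) := by
    rw [hk] at hre
    linear_combination hre
  have hD : 0 < 2 - 5 * d - 4 * ε + 10 * ε ^ 2 := by nlinarith [sq_nonneg ε]
  have hA : 0 < 3 - 8 * ε + 20 * ε ^ 2 - 10 * d := by nlinarith [sq_nonneg ε]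
  have hB : 0 < 5 - 12 * ε + 30 * ε ^ 2 - 15 * d := by nlinarith [sq_nonneg ε]
  have hsA0 := mul_pos hs0 hA
  have hsA1 := mul_lt_mul_of_pos_right hs1 hA
  have htB0 := mul_pos ht0 hB
  have htB1 := mul_lt_mul_of_pos_right ht1 hB
  have hn1 : (n:ℝ) < 3 := by
    by_contra h
    have := mul_le_mul_of_nonneg_right (not_lt.mp h) hD.le
    nlinarith [sq_nonneg ε]
  have hn2 : (-4:ℝ) < n := by
    by_contra h
    have := mul_le_mul_of_nonneg_right (not_lt.mp h) hD.le
    nlinarith [sq_nonneg ε]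
  have hn1' : n ≤ 2 := by
    have : n < 3 := by exact_mod_cast hn1
    omega
  have hn2' : -3 ≤ n := by
    have : -4 < n := by exact_mod_cast hn2
    omega
  have hn1r : (n:ℝ) ≤ 2 := by exact_mod_cast hn1'
  have hn2r : (-3:ℝ) ≤ n := by exact_mod_cast hn2'
  have e1 := mul_le_mul_of_nonneg_right hn1r hε0.le
  have e2 := mul_le_mul_of_nonneg_right hn2r hε0.le
  have p1 : 0 < 1 - 2 * ε := by linarith
  have p2 : 0 < 1 - 3 * ε := by linarith
  have f1 := mul_pos hs0 p1
  have f2 := mul_lt_mul_of_pos_right hs1 p1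
  have f3 := mul_pos ht0 p2
  have f4 := mul_lt_mul_of_pos_right ht1 p2
  have k1 : k < 1 := by
    have : (k:ℝ) < 1 := by linarith
    exact_mod_cast this
  have k2 : -1 < k := by
    have : (-1:ℝ) < k := by linarith
    exact_mod_cast this
  obtain rfl : k = 0 := by omega
  have c1 : 0 < 1 - 10 * ε + 10 * d := by linarith
  have c2 : 0 < 1 + 10 * ε - 15 * d := by linarith
  have g1 := mul_pos hs0 c1
  have g2 := mul_lt_mul_of_pos_right hs1 c1
  have g3 := mul_pos ht0 c2
  have g4 := mul_lt_mul_of_pos_right ht1 c2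
  push_cast at hre
  have h1 : n < 0 := by
    by_contra h
    have h' : (0:ℝ) ≤ n := by exact_mod_cast not_lt.mp h
    have : 0 ≤ (n:ℝ) * (2 - 5 * d) := mul_nonneg h' (by linarith)
    linarith
  have h2 : -1 < n := by
    by_contra h
    have h' : (n:ℝ) ≤ -1 := by exact_mod_cast not_lt.mp h
    have := mul_le_mul_of_nonneg_right h' (show 0 ≤ 2 - 5 * d by linarith)
    linarith
  omega

/-- For `0 < α < ε < 1/10` and `β = -1 + ε`, no integral linear combination of
`Z_{α,β}(v)` and `Z_{α,β}(w)` lies in the open parallelogram spanned by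
`p₁ = Z_{α,β}(𝓔)` and `p₂ = Z_{α,β}(𝒬(-H)[1]) = -Z_{α,β}(𝒬(-H))`; explicitly,
`Z_{α,β}(v) = (5α² - 2 + 10ε - 5ε²) + 10(1-ε)i`, `Z_{α,β}(w) = (-4 + 10ε) + 10i`,
`p₁ = (10α² - 1 + 10ε - 10ε²) + 10(1-2ε)i`, `p₂ = (-15α² - 1 - 10ε + 15ε²) - 10(1-3ε)i`,
and `p₁ + p₂ = Z_{α,β}(w) - Z_{α,β}(v)`, so `(n,m) = (-1,1)` gives exactly the closed
corner `s = t = 1`. This is the numerical verification that `π(𝓔)` is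
`σ(α, -1+ε)`-stable in `𝒦u(X)`. -/
theorem stmt8 (α ε : ℝ) (hα : 0 < α) (hαε : α < ε) (hε : ε < 1/10) :
    (∀ n m : ℤ, ∀ s t : ℝ, 0 < s → s < 1 → 0 < t → t < 1 →
      (n : ℂ) * Z α (-1 + ε) v + (m : ℂ) * Z α (-1 + ε) w ≠
        (s : ℂ) * Z α (-1 + ε) e + (t : ℂ) * (-Z α (-1 + ε) q)) ∧
    Z α (-1 + ε) v =
      ((5 * α ^ 2 - 2 + 10 * ε - 5 * ε ^ 2 : ℝ) : ℂ)
        + ((10 * (1 - ε) : ℝ) : ℂ) * Complex.I ∧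
    Z α (-1 + ε) w = ((-4 + 10 * ε : ℝ) : ℂ) + ((10 : ℝ) : ℂ) * Complex.I ∧
    Z α (-1 + ε) e =
      ((10 * α ^ 2 - 1 + 10 * ε - 10 * ε ^ 2 : ℝ) : ℂ)
        + ((10 * (1 - 2 * ε) : ℝ) : ℂ) * Complex.I ∧
    -Z α (-1 + ε) q =
      ((-15 * α ^ 2 - 1 - 10 * ε + 15 * ε ^ 2 : ℝ) : ℂ)
        - ((10 * (1 - 3 * ε) : ℝ) : ℂ) * Complex.I ∧
    Z α (-1 + ε) e + (-Z α (-1 + ε) q) = Z α (-1 + ε) w - Z α (-1 + ε) v := by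
  have hv : Z α (-1 + ε) v =
      ((5 * α ^ 2 - 2 + 10 * ε - 5 * ε ^ 2 : ℝ) : ℂ)
        + ((10 * (1 - ε) : ℝ) : ℂ) * Complex.I := by
    simp only [Z, v]; push_cast; ring
  have hw : Z α (-1 + ε) w = ((-4 + 10 * ε : ℝ) : ℂ) + ((10 : ℝ) : ℂ) * Complex.I := by
    simp only [Z, w]; push_cast; ring
  have he : Z α (-1 + ε) e =
      ((10 * α ^ 2 - 1 + 10 * ε - 10 * ε ^ 2 : ℝ) : ℂ)
        + ((10 * (1 - 2 * ε) : ℝ) : ℂ) * Complex.I := by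
    simp only [Z, e]; push_cast; ring
  have hq : -Z α (-1 + ε) q =
      ((-15 * α ^ 2 - 1 - 10 * ε + 15 * ε ^ 2 : ℝ) : ℂ)
        - ((10 * (1 - 3 * ε) : ℝ) : ℂ) * Complex.I := by
    simp only [Z, q]; push_cast; ring
  refine ⟨?_, hv, hw, he, hq, ?_⟩
  · intro n m s t hs0 hs1 ht0 ht1 h
    rw [hv, hw, he, hq] at h
    have h1 := congrArg Complex.re h
    have h2 := congrArg Complex.im h
    simp only [Complex.add_re, Complex.add_im, Complex.sub_re, Complex.sub_im, Complex.mul_re,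
      Complex.mul_im, Complex.ofReal_re, Complex.ofReal_im, Complex.I_re, Complex.I_im,
      Complex.intCast_re, Complex.intCast_im] at h1 h2
    refine aux (ε ^ 2 - α ^ 2) ε (hα.trans hαε) hε (by nlinarith) (by nlinarith) n m s t
      hs0 hs1 ht0 ht1 (by linarith) (by linarith)
  · rw [hv, hw, he, hq]; push_cast; ring

end GMpaper
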